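/- arXiv:1906.01718 — 2 statements merged into one kernel-verified Lean document; each statement's English description precedes it below -/
import Mathlib

section
/- Let 0 < ν < e^{−e} and define the sequence (x_k) by x₁ = ln(ν⁻¹) and x_{k+1} = ln(ν⁻¹) − ln(x_k) for k ≥ 1. Then the sequence (x_k) converges to the unique positive solution x(ν) of the equation e^{−x} = ν·x. -/
open Filter Topology

/-- The logarithm is `c⁻¹`-Lipschitz on `[c, ∞)`. -/
lemma abs_log_sub_log_le {c a b : ℝ} (hc : 0 < c) (ha : c ≤ a) (hb : c ≤ b) :
    |Real.log a - Real.log b| ≤ c⁻¹ * |a - b| := by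
  have key : ∀ {u v : ℝ}, c ≤ u → c ≤ v →
      Real.log u - Real.log v ≤ c⁻¹ * |u - v| := by
    intro u v hu hv
    have hu0 : 0 < u := hc.trans_le hu
    have hv0 : 0 < v := hc.trans_le hv
    calc Real.log u - Real.log v = Real.log (u / v) := (Real.log_div hu0.ne' hv0.ne').symm
      _ ≤ u / v - 1 := Real.log_le_sub_one_of_pos (div_pos hu0 hv0)
      _ = v⁻¹ * (u - v) := by field_simp
      _ ≤ v⁻¹ * |u - v| := by gcongr; exact le_abs_self _
      _ ≤ c⁻¹ * |u - v| := by gcongr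
  rw [abs_sub_le_iff]
  exact ⟨key ha hb, abs_sub_comm a b ▸ key hb ha⟩

lemma log_le_sub_of_exp_one_lt {L : ℝ} (hL : Real.exp 1 < L) : Real.log L ≤ L - 3 / 2 := by
  have he : 2.7 < Real.exp 1 := by linarith [Real.exp_one_gt_d9]
  have hL0 : 0 < L := by linarith
  have h1 : Real.log L ≤ L / Real.exp 1 := by
    have h := Real.log_le_sub_one_of_pos (div_pos hL0 (Real.exp_pos 1))
    rw [Real.log_div hL0.ne' (Real.exp_pos 1).ne', Real.log_exp] at h
    linarith
  refine h1.trans ?_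
  rw [div_le_iff₀ (Real.exp_pos 1)]
  nlinarith

/-- For `0 < ν < e^{-e}`, the fixed-point iteration `x₁ = ln(ν⁻¹)`,
`x_{k+1} = ln(ν⁻¹) − ln(x_k)` converges to the unique positive solution of
`e^{-x} = ν·x`. -/
theorem iteration_tendsto_solution (ν : ℝ) (hν0 : 0 < ν)
    (hν1 : ν < Real.exp (-Real.exp 1))
    (x : ℕ → ℝ) (hx1 : x 1 = Real.log ν⁻¹)
    (hrec : ∀ k : ℕ, 1 ≤ k → x (k + 1) = Real.log ν⁻¹ - Real.log (x k))
    (xs : ℝ) (hxs_pos : 0 < xs) (hxs_sol : Real.exp (-xs) = ν * xs) :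
    Tendsto x atTop (𝓝 xs) := by
  have hfix : xs = Real.log ν⁻¹ - Real.log xs := by
    have h := congrArg Real.log hxs_sol
    rw [Real.log_exp, Real.log_mul hν0.ne' hxs_pos.ne'] at h
    rw [Real.log_inv]
    linarith
  have hL : Real.exp 1 < Real.log ν⁻¹ := by
    rw [Real.log_inv]
    linarith [(Real.log_lt_iff_lt_exp hν0).2 hν1]
  generalize Real.log ν⁻¹ = L at *
  have he : 2.7 < Real.exp 1 := by linarith [Real.exp_one_gt_d9]
  have hlog := log_le_sub_of_exp_one_lt hL
  have hxs1 : 1 ≤ xs := by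
    by_contra! h
    linarith [Real.log_nonpos hxs_pos.le h.le]
  have hxsL : xs ≤ L := by linarith [Real.log_nonneg hxs1]
  have hxs : 3 / 2 ≤ xs := by linarith [Real.log_le_log hxs_pos hxsL]
  have hinv : ∀ n : ℕ, 3 / 2 ≤ x (n + 1) ∧ x (n + 1) ≤ L := by
    intro n
    induction n with
    | zero => simp only [zero_add, hx1]; constructor <;> linarith
    | succ n ih =>
      obtain ⟨h1, h2⟩ := ih
      rw [hrec (n + 1) (by omega)]
      have h3 := Real.log_nonneg (show 1 ≤ x (n + 1) by linarith)
      have h4 := Real.log_le_log (show 0 < x (n + 1) by linarith) h2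
      constructor <;> linarith
  have hbound : ∀ n : ℕ, |x (n + 1) - xs| ≤ (3 / 2 : ℝ)⁻¹ ^ n * |x 1 - xs| := by
    intro n
    induction n with
    | zero => simp
    | succ n ih =>
      calc |x (n + 1 + 1) - xs| = |Real.log xs - Real.log (x (n + 1))| := by
            rw [hrec (n + 1) (by omega)]
            congr 1
            linarith
        _ ≤ (3 / 2 : ℝ)⁻¹ * |x (n + 1) - xs| := by
            rw [abs_sub_comm (x (n + 1))]
            exact abs_log_sub_log_le (by norm_num) hxs (hinv n).1
        _ ≤ (3 / 2 : ℝ)⁻¹ * ((3 / 2 : ℝ)⁻¹ ^ n * |x 1 - xs|) := by gcongr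
        _ = (3 / 2 : ℝ)⁻¹ ^ (n + 1) * |x 1 - xs| := by ring
  rw [← tendsto_add_atTop_iff_nat 1, tendsto_iff_dist_tendsto_zero]
  refine squeeze_zero (fun _ => dist_nonneg) hbound ?_
  simpa using (tendsto_pow_atTop_nhds_zero_of_lt_one (r := (3 / 2 : ℝ)⁻¹)
    (by norm_num) (by norm_num)).mul_const |x 1 - xs|
end

section
/- Let x(ν) denote the unique positive solution of e^{−x} = ν·x for ν > 0. With L = ln(ν⁻¹), φ₁ = L, φ₂ = −ln L, φ₃ = (ln L)/L, and φ₄ = −φ₃/L + φ₃²/2, one has (x(ν) − φ₁ − φ₂ − φ₃ − φ₄)/φ₄ → 0 as ν → 0⁺; i.e., φ₁ + φ₂ + φ₃ + φ₄ is a four-term asymptotic series approximation of x(ν). -/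
open Filter Topology Real

noncomputable def Lf (ν : ℝ) : ℝ := Real.log ν⁻¹

noncomputable def φ₁ (ν : ℝ) : ℝ := Lf ν

noncomputable def φ₂ (ν : ℝ) : ℝ := -Real.log (Lf ν)

noncomputable def φ₃ (ν : ℝ) : ℝ := Real.log (Lf ν) / Lf ν

noncomputable def φ₄ (ν : ℝ) : ℝ := -φ₃ ν / Lf ν + (φ₃ ν) ^ 2 / 2

noncomputable def φ₅ (ν : ℝ) : ℝ := (φ₄ ν) ^ 2 - (φ₃ ν) ^ 3 / 6 - φ₄ ν / Lf ν

noncomputable def φ₆ (ν : ℝ) : ℝ :=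
  φ₃ ν * φ₅ ν + (φ₄ ν) ^ 2 / 2 - (φ₃ ν) ^ 2 * φ₄ ν / 2 - φ₅ ν / Lf ν

/-- A solution of `x + log x = L`, corrected by its first two approximants, agrees with
`a + a ^ 2 / 2 - a / L` up to a multiple of `a ^ 3`, where `a = log L / L`. -/
theorem abs_sub_le_of_add_log_eq {x L a : ℝ} (hx : 0 < x) (hxL : x + log x = L) (hL : 2 ≤ L)
    (hlog : 1 ≤ log L) (ha : a = log L / L) (ha2 : a ≤ 1 / 2) :
    |x - L + log L - a - (a ^ 2 / 2 - a / L)| ≤ 8 * a ^ 3 := by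
  have hL0 : 0 < L := by linarith
  have hLa : log L = a * L := by rw [ha]; field_simp
  have ha0 : 0 < a := by rw [ha]; positivity
  have hinv : 1 / L ≤ a := by rw [ha]; gcongr
  have hinv0 : 0 < 1 / L := by positivity
  have hx1 : 1 ≤ x := by
    by_contra! h
    have := log_neg hx h
    linarith
  have hlogx : 0 ≤ log x := log_nonneg hx1
  set w := log L - log x with hw
  have hw0 : 0 ≤ w := sub_nonneg.2 (log_le_log hx (by linarith))
  have hu : x / L = 1 - (a - w * (1 / L)) := by
    have : x = L - a * L + w := by linarith
    rw [this]; field_simp; ring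
  have hwu : w = -log (1 - (a - w * (1 / L))) := by
    rw [← hu, log_div hx.ne' hL0.ne']; ring
  have hwL0 : 0 ≤ w * (1 / L) := by positivity
  have hw2 : w ≤ 2 * a := by
    have h1 : 0 < 1 - a := by linarith
    have h2 : log (1 - a) ≤ log (1 - (a - w * (1 / L))) := log_le_log h1 (by linarith)
    have h3 := one_sub_inv_le_log_of_pos h1
    have h4 : (1 - a)⁻¹ ≤ 1 + 2 * a := by
      rw [inv_le_iff_one_le_mul₀ h1]; nlinarith
    linarith
  have hhalf : 1 / L ≤ 1 / 2 := by gcongr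
  have hwL : w * (1 / L) ≤ 2 * a ^ 2 := by nlinarith
  have hwLa : w * (1 / L) ≤ a := by nlinarith
  set t := a - w * (1 / L) with ht
  have ht0 : 0 ≤ t := by linarith
  have hta : t ≤ a := by linarith
  have hlt : |t| < 1 := by rw [abs_of_nonneg ht0]; linarith
  have hpos : 0 < 1 - t := by linarith
  have htwo : 1 / (1 - t) ≤ 2 := by
    rw [div_le_iff₀ (by linarith)]; linarith
  have hfst : |w - t| ≤ 2 * a ^ 2 := by
    have h := abs_log_sub_add_sum_range_le hlt 1
    rw [abs_of_nonneg ht0] at h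
    simp only [Finset.sum_range_one] at h
    norm_num at h
    have h1 : t ^ 2 / (1 - t) ≤ 2 * a ^ 2 := by
      calc t ^ 2 / (1 - t) = t ^ 2 * (1 / (1 - t)) := by ring
        _ ≤ a ^ 2 * 2 := by gcongr
        _ = 2 * a ^ 2 := by ring
    rw [abs_sub_comm]
    rw [show t - w = t + log (1 - t) by linarith]
    exact h.trans h1
  have hsnd : |w - t - t ^ 2 / 2| ≤ 2 * a ^ 3 := by
    have h := abs_log_sub_add_sum_range_le hlt 2
    rw [abs_of_nonneg ht0] at h
    simp only [Finset.sum_range_succ, Finset.sum_range_zero] at h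
    norm_num at h
    have h1 : t ^ 3 / (1 - t) ≤ 2 * a ^ 3 := by
      calc t ^ 3 / (1 - t) = t ^ 3 * (1 / (1 - t)) := by ring
        _ ≤ a ^ 3 * 2 := by gcongr
        _ = 2 * a ^ 3 := by ring
    rw [← abs_neg]
    rw [show -(w - t - t ^ 2 / 2) = t + t ^ 2 / 2 + log (1 - t) by linarith]
    exact h.trans h1
  have hthd : |(w - a) * (1 / L)| ≤ 4 * a ^ 3 := by
    have h : |w - a| ≤ 4 * a ^ 2 := by
      rw [abs_le] at hfst ⊢
      constructor <;> nlinarith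
    rw [abs_mul, abs_of_pos hinv0]
    calc |w - a| * (1 / L) ≤ 4 * a ^ 2 * a := by gcongr
      _ = 4 * a ^ 3 := by ring
  have hfth : |(t + a) * (w * (1 / L)) / 2| ≤ 2 * a ^ 3 := by
    rw [abs_of_nonneg (by positivity)]
    calc (t + a) * (w * (1 / L)) / 2 ≤ (a + a) * (2 * a ^ 2) / 2 := by gcongr
      _ = 2 * a ^ 3 := by ring
  have key : x - L + log L - a - (a ^ 2 / 2 - a / L)
      = (w - t - t ^ 2 / 2) - (w - a) * (1 / L) - (t + a) * (w * (1 / L)) / 2 := by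
    have : x - L + log L = w := by linarith
    rw [this, ht]; ring
  rw [key]
  rw [abs_le] at *
  constructor <;> linarith

theorem tendsto_Lf_atTop : Tendsto Lf (𝓝[>] 0) atTop :=
  tendsto_log_atTop.comp tendsto_inv_nhdsGT_zero

theorem tendsto_φ₃_zero : Tendsto φ₃ (𝓝[>] 0) (𝓝 0) :=
  (isLittleO_log_id_atTop.tendsto_div_nhds_zero).comp tendsto_Lf_atTop

theorem sq_div_four_le_φ₄ {ν : ℝ} (hL : 0 < Lf ν) (hlog : 4 ≤ log (Lf ν)) :
    φ₃ ν ^ 2 / 4 ≤ φ₄ ν := by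
  have h : φ₄ ν - φ₃ ν ^ 2 / 4 = log (Lf ν) * (log (Lf ν) - 4) / (4 * Lf ν ^ 2) := by
    unfold φ₄ φ₃; field_simp; ring
  have : 0 ≤ log (Lf ν) * (log (Lf ν) - 4) / (4 * Lf ν ^ 2) :=
    div_nonneg (mul_nonneg (by linarith) (by linarith)) (by positivity)
  linarith

/-- Four-term asymptotic series approximation: if `x ν` is the unique positive
solution of `e^{-x} = ν·x`, then `(x(ν) − φ₁ − φ₂ − φ₃ − φ₄)/φ₄ → 0` as
`ν → 0⁺`. -/
theorem four_term_asymptotic_series (x : ℝ → ℝ)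
    (hx : ∀ ν : ℝ, 0 < ν → 0 < x ν ∧ Real.exp (-(x ν)) = ν * x ν) :
    Tendsto (fun ν : ℝ => (x ν - φ₁ ν - φ₂ ν - φ₃ ν - φ₄ ν) / φ₄ ν)
      (𝓝[>] (0 : ℝ)) (𝓝 0) := by
  refine squeeze_zero_norm' (a := fun ν => 32 * φ₃ ν) ?_
    (by simpa using tendsto_φ₃_zero.const_mul 32)
  filter_upwards [self_mem_nhdsWithin, tendsto_Lf_atTop.eventually_ge_atTop 2,
    (tendsto_log_atTop.comp tendsto_Lf_atTop).eventually_ge_atTop 4,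
    tendsto_φ₃_zero.eventually_le_const (show (0 : ℝ) < 1 / 2 by norm_num)]
    with ν hν hL hlog ha
  replace hν : 0 < ν := hν
  replace hlog : 4 ≤ log (Lf ν) := hlog
  obtain ⟨hx0, hxe⟩ := hx ν hν
  have hxL : x ν + log (x ν) = Lf ν := by
    have h := congrArg log hxe
    rw [log_exp, log_mul hν.ne' hx0.ne'] at h
    rw [Lf, log_inv]; linarith
  have hb := abs_sub_le_of_add_log_eq hx0 hxL hL (by linarith) (a := φ₃ ν) rfl ha
  have h3 : 0 < φ₃ ν := div_pos (by linarith) (by linarith)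
  have h4 := sq_div_four_le_φ₄ (by linarith) hlog
  have h4pos : 0 < φ₄ ν := lt_of_lt_of_le (by positivity) h4
  have hnum : x ν - φ₁ ν - φ₂ ν - φ₃ ν - φ₄ ν
      = x ν - Lf ν + log (Lf ν) - φ₃ ν - (φ₃ ν ^ 2 / 2 - φ₃ ν / Lf ν) := by
    rw [φ₁, φ₂, φ₄]; ring
  rw [norm_eq_abs, abs_div, abs_of_pos h4pos, div_le_iff₀ h4pos, hnum]
  calc _ ≤ 8 * φ₃ ν ^ 3 := hb
    _ = 32 * φ₃ ν * (φ₃ ν ^ 2 / 4) := by ring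
    _ ≤ 32 * φ₃ ν * φ₄ ν := by gcongr
end
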